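/- arXiv:math-ph/0109018 — 2 statements merged into one kernel-verified Lean document; each statement's English description precedes it below -/
import Mathlib

section
/- (Main theorem, explicit 2×2 differential system.) For every n ≥ 1 and every x ∈ ℝ: ψ_{n−1}'(x) = ( (1/2)V'(x) + γ_n R_{n−1,n}(x) ) ψ_{n−1}(x) − γ_n R_{n−1,n−1}(x) ψ_n(x), and ψ_n'(x) = γ_n R_{n,n}(x) ψ_{n−1}(x) − ( (1/2)V'(x) + γ_n R_{n,n−1}(x) ) ψ_n(x). Equivalently, the vector (ψ_{n−1}, ψ_n) satisfies d/dx (ψ_{n−1}, ψ_n)ᵀ = 𝒟_n(x)(ψ_{n−1}, ψ_n)ᵀ with 𝒟_n(x) = (1/2)V'(x)·diag(1,−1) + [[R_{n−1,n−1}, R_{n−1,n}],[R_{n,n−1}, R_{n,n}]]·[[0, −γ_n],[γ_n, 0]]. -/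
open MeasureTheory Polynomial Real

section LinearFunctional

variable {L : ℝ[X] →ₗ[ℝ] ℝ} {p : ℕ → ℝ[X]}

theorem orthogonal_of_degree_lt (hmonic : ∀ n, (p n).Monic) (hpdeg : ∀ n, (p n).natDegree = n)
    (horth : ∀ n m, n ≠ m → L (p n * p m) = 0) (n : ℕ) (q : ℝ[X]) (hq : q.degree < n) :
    L (p n * q) = 0 := by
  suffices H : ∀ d ≤ n, ∀ q : ℝ[X], q.degree < d → L (p n * q) = 0 from H n le_rfl q hq
  intro d
  induction d with
  | zero =>
    intro _ q hq
    have : q = 0 := by simpa using hq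
    simp [this]
  | succ d ih =>
    intro hd q hq
    have hlow : (q - C (q.coeff d) * p d).degree < d := by
      rw [degree_lt_iff_coeff_zero] at hq ⊢
      intro k hk
      rcases hk.eq_or_lt with rfl | hk
      · have : (p d).coeff d = 1 := by simpa [Monic, leadingCoeff, hpdeg] using hmonic d
        simp [this]
      · have : (p d).coeff k = 0 := coeff_eq_zero_of_natDegree_lt (by rwa [hpdeg])
        simp [this, hq k hk]
    have hsplit : p n * q = p n * (q - C (q.coeff d) * p d) + q.coeff d • (p n * p d) := by
      rw [smul_eq_C_mul]; ring
    rw [hsplit, map_add, map_smul, ih (by omega) _ hlow, horth n d (by omega)]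
    simp

theorem apply_mul_monic (hmonic : ∀ n, (p n).Monic) (hpdeg : ∀ n, (p n).natDegree = n)
    (horth : ∀ n m, n ≠ m → L (p n * p m) = 0) (n : ℕ) (q : ℝ[X]) (hq : q.Monic)
    (hqdeg : q.natDegree = n) : L (p n * q) = L (p n * p n) := by
  have hlow : (q - p n).degree < n := by
    have hd : q.degree = n := by rw [degree_eq_natDegree hq.ne_zero, hqdeg]
    have hd' : (p n).degree = n := by rw [degree_eq_natDegree (hmonic n).ne_zero, hpdeg]
    rw [← hd]
    exact degree_sub_lt_left (hd.trans hd'.symm) hq.ne_zero (hq.trans (hmonic n).symm)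
  have := orthogonal_of_degree_lt hmonic hpdeg horth n _ hlow
  rwa [mul_sub, map_sub, sub_eq_zero] at this

/-- The Christoffel–Darboux kernel at `x`, multiplied by the squared norm of `p m`: a polynomial
in the other variable that reproduces polynomials of degree at most `m`. -/
theorem exists_reproducing_kernel (hmonic : ∀ n, (p n).Monic) (hpdeg : ∀ n, (p n).natDegree = n)
    (horth : ∀ n m, n ≠ m → L (p n * p m) = 0) (m : ℕ) (x : ℝ) :
    ∃ K : ℝ[X], K.degree < (m + 1 : ℕ) ∧
      (X - C x) * K = C ((p m).eval x) * p (m + 1) - C ((p (m + 1)).eval x) * p m ∧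
      ∀ q : ℝ[X], q.degree < (m + 1 : ℕ) → L (K * q) = L (p m * p m) * q.eval x := by
  have hdiv (f : ℝ[X]) : (X - C x) * (f /ₘ (X - C x)) = f - C (f.eval x) := by
    have := modByMonic_add_div f (X - C x)
    rw [modByMonic_X_sub_C_eq_C_eval] at this
    linear_combination this
  have hdeg (f : ℝ[X]) (k : ℕ) (hf : f.degree < (k + 1 : ℕ)) :
      (f /ₘ (X - C x)).degree < k := by
    rw [degree_lt_iff_coeff_zero]
    intro j hj
    apply coeff_eq_zero_of_degree_lt
    by_cases h0 : f = 0
    · simp [h0, bot_lt_iff_ne_bot]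
    by_cases h1 : f /ₘ (X - C x) = 0
    · simp [h1, bot_lt_iff_ne_bot]
    rw [degree_eq_natDegree h0] at hf
    rw [degree_eq_natDegree h1, natDegree_divByMonic _ (monic_X_sub_C x), natDegree_X_sub_C]
    have hf' : f.natDegree < k + 1 := by exact_mod_cast hf
    have hpos : f.natDegree ≠ 0 := by
      intro hz
      apply h1
      rw [divByMonic_eq_zero_iff (monic_X_sub_C x), degree_X_sub_C, degree_eq_natDegree h0, hz]
      exact_mod_cast Nat.zero_lt_one
    have : f.natDegree - 1 < j := by omega
    exact_mod_cast this
  have hdegp (k : ℕ) : (p k).degree < (k + 1 : ℕ) := by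
    rw [degree_eq_natDegree (hmonic k).ne_zero, hpdeg]
    exact_mod_cast Nat.lt_succ_self k
  set U := p (m + 1) /ₘ (X - C x) with hU
  set S := p m /ₘ (X - C x) with hS
  have hUx : (X - C x) * U = p (m + 1) - C ((p (m + 1)).eval x) := hdiv _
  have hSx : (X - C x) * S = p m - C ((p m).eval x) := hdiv _
  have hUdeg : U.degree < (m + 1 : ℕ) := hdeg _ _ (hdegp _)
  have hSdeg : S.degree < m := hdeg _ _ (hdegp _)
  have hSdeg' : S.degree < (m + 1 : ℕ) := hSdeg.trans (by exact_mod_cast Nat.lt_succ_self m)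
  have hUmonic : U.Monic := by
    have hle : (X - C x).degree ≤ (p (m + 1)).degree := by
      rw [degree_X_sub_C, degree_eq_natDegree (hmonic _).ne_zero, hpdeg]
      exact_mod_cast Nat.succ_le_succ (Nat.zero_le m)
    rw [Monic, hU, leadingCoeff_divByMonic_of_monic (monic_X_sub_C x) hle]
    exact hmonic _
  have hUnat : U.natDegree = m := by
    rw [hU, natDegree_divByMonic _ (monic_X_sub_C x), natDegree_X_sub_C, hpdeg]
    omega
  have hKX : (X - C x) * (C ((p m).eval x) * U - C ((p (m + 1)).eval x) * S)
      = C ((p m).eval x) * p (m + 1) - C ((p (m + 1)).eval x) * p m := by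
    linear_combination C ((p m).eval x) * hUx - C ((p (m + 1)).eval x) * hSx
  have hL1 : L (C ((p m).eval x) * U - C ((p (m + 1)).eval x) * S) = L (p m * p m) := by
    have h1 := orthogonal_of_degree_lt hmonic hpdeg horth (m + 1) S hSdeg'
    have h2 := apply_mul_monic hmonic hpdeg horth m U hUmonic hUnat
    have h3 : C ((p m).eval x) * U - C ((p (m + 1)).eval x) * S
        = p m * U - p (m + 1) * S := by
      linear_combination U * hSx - S * hUx
    rw [h3, map_sub, h1, h2, sub_zero]
  refine ⟨C ((p m).eval x) * U - C ((p (m + 1)).eval x) * S, ?_, hKX, ?_⟩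
  · rw [degree_lt_iff_coeff_zero] at hUdeg hSdeg' ⊢
    intro k hk
    simp [hUdeg k hk, hSdeg' k hk]
  · intro q hq
    have hs := hdeg q m hq
    have hs' : (q /ₘ (X - C x)).degree < (m + 1 : ℕ) :=
      hs.trans (by exact_mod_cast Nat.lt_succ_self m)
    have hsplit : (C ((p m).eval x) * U - C ((p (m + 1)).eval x) * S) * q
        = q.eval x • (C ((p m).eval x) * U - C ((p (m + 1)).eval x) * S)
          + ((p m).eval x • (p (m + 1) * (q /ₘ (X - C x)))
            - (p (m + 1)).eval x • (p m * (q /ₘ (X - C x)))) := by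
      simp only [smul_eq_C_mul]
      linear_combination (q /ₘ (X - C x)) * hKX
        - (C ((p m).eval x) * U - C ((p (m + 1)).eval x) * S) * hdiv q
    rw [hsplit, map_add, map_sub, map_smul, map_smul, map_smul, hL1,
      orthogonal_of_degree_lt hmonic hpdeg horth _ _ hs,
      orthogonal_of_degree_lt hmonic hpdeg horth _ _ hs']
    simp [mul_comm]

/-- The ladder relations for monic polynomials orthogonal with respect to a functional `L` that
satisfies `L q' = L (V' q)`, where `D` plays the role of `V'`. -/
theorem derivative_orthogonal_polynomials (hmonic : ∀ n, (p n).Monic)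
    (hpdeg : ∀ n, (p n).natDegree = n) (horth : ∀ n m, n ≠ m → L (p n * p m) = 0)
    {D : ℝ[X]} (hparts : ∀ q, L (derivative q) = L (D * q))
    {x : ℝ} {W : ℝ[X]} (hW : (X - C x) * W = D - C (D.eval x)) (m : ℕ) :
    L (p m * p m) * (derivative (p m)).eval x
        = (L (p m * p m) * D.eval x + L (W * p m * p (m + 1))) * (p m).eval x
          - L (W * p m * p m) * (p (m + 1)).eval x ∧
    L (p m * p m) * (derivative (p (m + 1))).eval x
        = L (W * p (m + 1) * p (m + 1)) * (p m).eval x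
          - L (W * p (m + 1) * p m) * (p (m + 1)).eval x := by
  obtain ⟨K, hKdeg, hKX, hK⟩ := exists_reproducing_kernel hmonic hpdeg horth m x
  have hK'deg : (derivative K).degree < m := by
    rw [degree_lt_iff_coeff_zero] at hKdeg ⊢
    intro k hk
    rw [coeff_derivative, hKdeg (k + 1) (by omega), zero_mul]
  have hK'deg' : (derivative K).degree < (m + 1 : ℕ) :=
    hK'deg.trans (by exact_mod_cast Nat.lt_succ_self m)
  have key (f : ℝ[X]) (hf : f.natDegree ≤ m + 1) (hf0 : L (f * derivative K) = 0) :
      L (p m * p m) * (derivative f).eval x = D.eval x * L (K * f)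
        + (p m).eval x * L (W * f * p (m + 1)) - (p (m + 1)).eval x * L (W * f * p m) := by
    have hf' : (derivative f).degree < (m + 1 : ℕ) := by
      rw [degree_lt_iff_coeff_zero]
      intro k hk
      rw [coeff_derivative, coeff_eq_zero_of_natDegree_lt (by omega), zero_mul]
    have h1 := hparts (K * f)
    have h2 : D * (K * f) = D.eval x • (K * f)
        + ((p m).eval x • (W * f * p (m + 1)) - (p (m + 1)).eval x • (W * f * p m)) := by
      simp only [smul_eq_C_mul]
      linear_combination W * f * hKX - K * f * hW
    rw [derivative_mul, map_add, mul_comm (derivative K), hf0, hK _ hf', h2] at h1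
    simp only [map_add, map_sub, map_smul, smul_eq_mul] at h1
    linarith
  constructor
  · have h1 := key (p m) (by rw [hpdeg]; omega)
      (orthogonal_of_degree_lt hmonic hpdeg horth _ _ hK'deg)
    have h2 := hK (p m) (by
      rw [degree_eq_natDegree (hmonic m).ne_zero, hpdeg]
      exact_mod_cast Nat.lt_succ_self m)
    rw [h1, h2]
    ring
  · have h1 := key (p (m + 1)) (by rw [hpdeg])
      (orthogonal_of_degree_lt hmonic hpdeg horth _ _ hK'deg')
    have h2 := orthogonal_of_degree_lt hmonic hpdeg horth (m + 1) K hKdeg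
    rw [h1, mul_comm K, h2]
    ring

end LinearFunctional

/-- Integration of polynomials against the weight `exp (-V)`. -/
noncomputable def expWeightFunctional (V : ℝ[X])
    (hint : ∀ q : ℝ[X], Integrable (fun x : ℝ => q.eval x * Real.exp (-(V.eval x)))) :
    ℝ[X] →ₗ[ℝ] ℝ where
  toFun q := ∫ x : ℝ, q.eval x * Real.exp (-(V.eval x))
  map_add' q r := by
    simp only [eval_add, add_mul]
    exact integral_add (hint q) (hint r)
  map_smul' c q := by
    simp only [eval_smul, smul_eq_mul, mul_assoc, RingHom.id_apply]
    exact integral_const_mul c _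

theorem expWeightFunctional_derivative (V : ℝ[X])
    (hint : ∀ q : ℝ[X], Integrable (fun x : ℝ => q.eval x * Real.exp (-(V.eval x))))
    (q : ℝ[X]) :
    expWeightFunctional V hint (derivative q)
      = expWeightFunctional V hint (derivative V * q) := by
  rw [← sub_eq_zero, ← map_sub]
  have hderiv (x : ℝ) : HasDerivAt (fun x : ℝ => q.eval x * Real.exp (-(V.eval x)))
      ((derivative q - derivative V * q).eval x * Real.exp (-(V.eval x))) x := by
    refine ((q.hasDerivAt x).fun_mul (V.hasDerivAt x).fun_neg.exp).congr_deriv ?_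
    simp only [eval_sub, eval_mul]
    ring
  exact integral_eq_zero_of_hasDerivAt_of_integrable hderiv (hint _) (hint q)

theorem stmt6
    (V : Polynomial ℝ)
    (hVeven : Even V.natDegree) (hVdeg : 2 ≤ V.natDegree)
    (hVlead : 0 < V.leadingCoeff)
    (hint : ∀ q : Polynomial ℝ,
      Integrable (fun x : ℝ => q.eval x * Real.exp (-(V.eval x))))
    (p : ℕ → Polynomial ℝ)
    (hmonic : ∀ n, (p n).Monic)
    (hpdeg : ∀ n, (p n).natDegree = n)
    (horth : ∀ n m, n ≠ m →
      ∫ x : ℝ, (p n).eval x * (p m).eval x * Real.exp (-(V.eval x)) = 0)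
    (h : ℕ → ℝ)
    (hh : ∀ n, h n = ∫ x : ℝ, ((p n).eval x) ^ 2 * Real.exp (-(V.eval x)))
    (hhpos : ∀ n, 0 < h n)
    (ψ : ℕ → ℝ → ℝ)
    (hψ : ∀ n x, ψ n x = (p n).eval x * Real.exp (-(V.eval x) / 2) / Real.sqrt (h n))
    (γ : ℕ → ℝ)
    (hγ : ∀ n, 1 ≤ n → γ n = Real.sqrt (h n / h (n - 1)))
    (W : ℝ → Polynomial ℝ)
    (hW : ∀ x : ℝ, (X - C x) * W x = derivative V - C ((derivative V).eval x))
    (R : ℕ → ℕ → ℝ → ℝ)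
    (hR : ∀ i j (x : ℝ), R i j x = ∫ t : ℝ, (W x).eval t * ψ i t * ψ j t)
    (n : ℕ) (hn : 1 ≤ n) (x : ℝ) :
    deriv (ψ (n - 1)) x
      = ((1 / 2) * (derivative V).eval x + γ n * R (n - 1) n x) * ψ (n - 1) x
        - γ n * R (n - 1) (n - 1) x * ψ n x ∧
    deriv (ψ n) x
      = γ n * R n n x * ψ (n - 1) x
        - ((1 / 2) * (derivative V).eval x + γ n * R n (n - 1) x) * ψ n x := by
  obtain ⟨m, rfl⟩ : ∃ m, n = m + 1 := ⟨n - 1, by omega⟩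
  rw [Nat.add_sub_cancel]
  set L := expWeightFunctional V hint with hLdef
  have hL (q : ℝ[X]) : L q = ∫ x : ℝ, q.eval x * Real.exp (-(V.eval x)) := rfl
  have hLorth (i j : ℕ) (hij : i ≠ j) : L (p i * p j) = 0 := by
    simpa only [hL, eval_mul] using horth i j hij
  have hLh (i : ℕ) : L (p i * p i) = h i := by
    simp only [hL, hh, eval_mul, sq]
  obtain ⟨h1, h2⟩ := derivative_orthogonal_polynomials hmonic hpdeg hLorth
    (expWeightFunctional_derivative V hint) (hW x) m
  rw [hLh] at h1 h2
  have hexp (t : ℝ) :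
      Real.exp (-(V.eval t)) = Real.exp (-(V.eval t) / 2) * Real.exp (-(V.eval t) / 2) := by
    rw [← Real.exp_add]
    ring_nf
  have hRL (i j : ℕ) : R i j x = L (W x * p i * p j) / (√(h i) * √(h j)) := by
    rw [hR, hL, ← integral_div]
    congr 1
    ext t
    rw [hψ, hψ, hexp]
    simp only [eval_mul]
    field_simp
  have hderiv (i : ℕ) : deriv (ψ i) x = ((derivative (p i)).eval x
      - (1 / 2) * (derivative V).eval x * (p i).eval x)
        * Real.exp (-(V.eval x) / 2) / √(h i) := by
    rw [funext (hψ i)]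
    have := (((p i).hasDerivAt x).fun_mul
      ((V.hasDerivAt x).fun_neg.div_const 2).exp).div_const √(h i)
    rw [this.deriv]
    ring
  have hs0 : 0 < √(h m) := Real.sqrt_pos.2 (hhpos m)
  have hs1 : 0 < √(h (m + 1)) := Real.sqrt_pos.2 (hhpos (m + 1))
  have hγm : γ (m + 1) = √(h (m + 1)) / √(h m) := by
    rw [hγ _ hn, Nat.add_sub_cancel, Real.sqrt_div (hhpos _).le]
  have hsq : h m = √(h m) ^ 2 := (Real.sq_sqrt (hhpos m).le).symm
  rw [hsq] at h1 h2
  simp only [hderiv, hRL, hγm, hψ]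
  generalize √(h m) = a at *
  generalize √(h (m + 1)) = b at *
  constructor
  · field_simp
    linear_combination 2 * h1
  · field_simp
    linear_combination 2 * h2
end

section
/- (Trace identity.) For every u ∈ U, every k with 1 ≤ k ≤ D and every n ≥ 1: (M^k_{n,n}(u) − M^k_{n−1,n−1}(u))/(2k) = −∂(log γ_n)/∂u_k, i.e. the trace of the 2×2 deformation matrix 𝒰_k(x) equals minus the logarithmic derivative of γ_n with respect to u_k (sign fixed by the convention ∂V_u/∂u_k = x^k/k). -/
open MeasureTheory Polynomial Real

/-- A polynomial orthogonal to the monic polynomials `P m`, `m < n`, is orthogonal to every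
polynomial of degree less than `n`. -/
lemma integral_mul_eq_zero_of_degree_lt {w : ℝ → ℝ}
    (hw : ∀ q : ℝ[X], Integrable (fun x => q.eval x * w x))
    {P : ℕ → ℝ[X]} (hmonic : ∀ n, (P n).Monic) (hdeg : ∀ n, (P n).natDegree = n)
    (Q : ℝ[X]) (n : ℕ) (horth : ∀ m < n, ∫ x, (Q * P m).eval x * w x = 0)
    (r : ℝ[X]) (hr : r.degree < n) : ∫ x, (Q * r).eval x * w x = 0 := by
  induction n generalizing r with
  | zero =>
    have : r = 0 := by simpa using hr
    simp [this]
  | succ n ih =>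
    set a := r.coeff n
    have hs : (r - C a * P n).degree < n := by
      rw [degree_lt_iff_coeff_zero] at hr ⊢
      intro m hm
      rcases hm.eq_or_lt with rfl | hlt
      · have h1 : (P n).coeff n = 1 := by
          simpa [leadingCoeff, hdeg] using (hmonic n).leadingCoeff
        simp [h1, a]
      · have h1 : (P n).coeff m = 0 := coeff_eq_zero_of_natDegree_lt (by rwa [hdeg])
        simp [h1, hr m hlt]
    have h1 := ih (fun m hm => horth m (by omega)) _ hs
    have h2 := horth n (by omega)
    have h3 : ∀ x, (Q * r).eval x * w x =
        (Q * (r - C a * P n)).eval x * w x + a * ((Q * P n).eval x * w x) := by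
      intro x
      simp only [eval_mul, eval_sub, eval_C]
      ring
    simp_rw [h3]
    rw [integral_add (hw _) ((hw _).const_mul a), integral_const_mul, h1, h2]
    simp

/-- Differentiation under the integral sign for polynomial moments of an exponentially tilted
weight. -/
lemma hasDerivAt_integral_eval_mul_exp {w g : ℝ → ℝ} {c ε : ℝ} (hε : 0 < ε) (G : ℝ[X])
    (hg : ∀ x, g x = G.eval x)
    (hw : ∀ t ∈ Metric.closedBall c ε, ∀ q : ℝ[X],
      Integrable (fun x => q.eval x * (w x * exp (-((t - c) * g x)))))
    (q : ℝ[X]) :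
    HasDerivAt (fun t => ∫ x, q.eval x * (w x * exp (-((t - c) * g x))))
      (-∫ x, (q * G).eval x * w x) c := by
  have hc : c ∈ Metric.closedBall c ε := Metric.mem_closedBall_self hε.le
  have hp : c + ε ∈ Metric.closedBall c ε := by
    simp [abs_of_pos hε]
  have hm : c - ε ∈ Metric.closedBall c ε := by
    simp [abs_of_pos hε]
  have key := hasDerivAt_integral_of_dominated_loc_of_deriv_le (μ := volume) (𝕜 := ℝ)
    (F := fun t x => q.eval x * (w x * exp (-((t - c) * g x))))
    (F' := fun t x => -((q * G).eval x * (w x * exp (-((t - c) * g x)))))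
    (x₀ := c) (s := Metric.ball c ε)
    (bound := fun x => |(q * G).eval x * (w x * exp (-((c + ε - c) * g x)))| +
      |(q * G).eval x * (w x * exp (-((c - ε - c) * g x)))|)
    (Metric.ball_mem_nhds c hε) ?_ (hw c hc q) (hw c hc (q * G)).aestronglyMeasurable.neg ?_
    ((hw _ hp (q * G)).abs.add (hw _ hm (q * G)).abs) ?_
  · simpa [integral_neg] using key.2
  · filter_upwards [Metric.closedBall_mem_nhds c hε] with t ht
    exact (hw t ht q).aestronglyMeasurable
  · refine Filter.Eventually.of_forall fun x t ht => ?_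
    rw [Metric.mem_ball, Real.dist_eq, abs_lt] at ht
    have hexp : exp (-((t - c) * g x)) ≤
        exp (-((c + ε - c) * g x)) + exp (-((c - ε - c) * g x)) := by
      rcases le_total 0 (g x) with h0 | h0
      · have : exp (-((t - c) * g x)) ≤ exp (-((c - ε - c) * g x)) :=
          exp_le_exp.2 (by nlinarith)
        linarith [exp_pos (-((c + ε - c) * g x))]
      · have : exp (-((t - c) * g x)) ≤ exp (-((c + ε - c) * g x)) :=
          exp_le_exp.2 (by nlinarith)
        linarith [exp_pos (-((c - ε - c) * g x))]
    simp only [norm_neg, norm_mul, Real.norm_eq_abs, abs_mul, abs_exp]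
    calc _ ≤ |(q * G).eval x| * (|w x| *
          (exp (-((c + ε - c) * g x)) + exp (-((c - ε - c) * g x)))) := by gcongr
      _ = _ := by ring
  · refine Filter.Eventually.of_forall fun x t _ => ?_
    have h1 : HasDerivAt (fun t => -((t - c) * g x)) (-(1 * g x)) t :=
      (((hasDerivAt_id t).sub_const c).mul_const (g x)).neg
    refine ((h1.exp.const_mul (w x)).const_mul (q.eval x)).congr_deriv ?_
    simp only [eval_mul, hg]
    ring

/-- Derivative of the squared norm of monic orthogonal polynomials along an exponential tilt of the
weight. -/
lemma hasDerivAt_sq_norm_orthogonal {w g : ℝ → ℝ} {c ε : ℝ} (hε : 0 < ε) (G : ℝ[X])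
    (hg : ∀ x, g x = G.eval x)
    (hw : ∀ t ∈ Metric.closedBall c ε, ∀ q : ℝ[X],
      Integrable (fun x => q.eval x * (w x * exp (-((t - c) * g x)))))
    {P : ℝ → ℕ → ℝ[X]}
    (hmonic : ∀ t ∈ Metric.closedBall c ε, ∀ n, (P t n).Monic)
    (hdeg : ∀ t ∈ Metric.closedBall c ε, ∀ n, (P t n).natDegree = n)
    (horth : ∀ t ∈ Metric.closedBall c ε, ∀ n m, n ≠ m →
      ∫ x, (P t n * P t m).eval x * (w x * exp (-((t - c) * g x))) = 0)
    (hcoeff : ∀ n j, DifferentiableAt ℝ (fun t => (P t n).coeff j) c) (n : ℕ) :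
    HasDerivAt (fun t => ∫ x, (P t n * P t n).eval x * (w x * exp (-((t - c) * g x))))
      (-∫ x, (P c n * P c n * G).eval x * w x) c := by
  have hc : c ∈ Metric.closedBall c ε := Metric.mem_closedBall_self hε.le
  have hI : ∀ t ∈ Metric.closedBall c ε, ∀ s ∈ Metric.closedBall c ε,
      ∀ r ∈ Metric.closedBall c ε,
      ∫ x, (P t n * P s n).eval x * (w x * exp (-((t - c) * g x))) =
      ∫ x, (P t n * P r n).eval x * (w x * exp (-((t - c) * g x))) := by
    intro t ht s hs r hr
    have hlt : (P s n - P r n).degree < n := by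
      have hd : ∀ s ∈ Metric.closedBall c ε, (P s n).degree = n := fun s hs => by
        rw [degree_eq_natDegree (hmonic s hs n).ne_zero, hdeg s hs]
      have := degree_sub_lt_left (p := P s n) (q := P r n) (by rw [hd s hs, hd r hr])
        (hmonic s hs n).ne_zero
        (by rw [(hmonic s hs n).leadingCoeff, (hmonic r hr n).leadingCoeff])
      rwa [hd s hs] at this
    have h0 := integral_mul_eq_zero_of_degree_lt (hw t ht) (hmonic t ht) (hdeg t ht) (P t n) n
      (fun m hm => horth t ht n m hm.ne') _ hlt
    rw [← sub_eq_zero, ← integral_sub (hw t ht _) (hw t ht _), ← h0]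
    refine integral_congr_ae (Filter.Eventually.of_forall fun x => ?_)
    simp only [eval_mul, eval_sub]
    ring
  have hexpand : ∀ t ∈ Metric.closedBall c ε, ∀ s ∈ Metric.closedBall c ε,
      ∫ x, (P t n * P c n).eval x * (w x * exp (-((s - c) * g x))) =
      ∑ a ∈ Finset.range (n + 1), (P t n).coeff a *
        ∫ x, (X ^ a * P c n).eval x * (w x * exp (-((s - c) * g x))) := by
    intro t ht s hs
    simp_rw [← integral_const_mul]
    rw [← integral_finsetSum _ fun a _ => (hw s hs _).const_mul _]
    refine integral_congr_ae (Filter.Eventually.of_forall fun x => ?_)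
    simp only [eval_mul, eval_pow, eval_X]
    rw [eval_eq_sum_range (p := P t n), hdeg t ht, Finset.sum_mul, Finset.sum_mul]
    exact Finset.sum_congr rfl fun a _ => by ring
  set F : ℕ → ℝ → ℝ := fun a t =>
    ∫ x, (X ^ a * P c n).eval x * (w x * exp (-((t - c) * g x))) with hF
  have hFd : ∀ a, HasDerivAt (F a) (-∫ x, (X ^ a * P c n * G).eval x * w x) c := fun a =>
    hasDerivAt_integral_eval_mul_exp hε G hg hw _
  have hsum : HasDerivAt (fun t => (∑ a ∈ Finset.range (n + 1),
      (P t n).coeff a * (F a t - F a c)) +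
      ∫ x, (P c n * P c n).eval x * (w x * exp (-((c - c) * g x))))
      (∑ a ∈ Finset.range (n + 1), (P c n).coeff a *
        (-∫ x, (X ^ a * P c n * G).eval x * w x)) c := by
    refine HasDerivAt.add_const _ (HasDerivAt.fun_sum fun a _ => ?_)
    refine ((hcoeff n a).hasDerivAt.mul ((hFd a).sub_const (F a c))).congr_deriv ?_
    simp
  have hw0 : ∀ q : ℝ[X], Integrable (fun x => q.eval x * w x) := fun q => by
    simpa using hw c hc q
  refine (hsum.congr_of_eventuallyEq ?_).congr_deriv ?_
  · filter_upwards [Metric.closedBall_mem_nhds c hε] with t ht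
    have h1 : ∫ x, (P c n * P c n).eval x * (w x * exp (-((c - c) * g x))) =
        ∫ x, (P t n * P c n).eval x * (w x * exp (-((c - c) * g x))) := by
      rw [hI c hc c hc t ht, mul_comm]
    rw [h1, hI t ht t ht c hc, hexpand t ht t ht, hexpand t ht c hc, ← Finset.sum_add_distrib]
    exact Finset.sum_congr rfl fun a _ => by simp only [hF]; ring
  · simp_rw [mul_neg, Finset.sum_neg_distrib, ← integral_const_mul]
    rw [← integral_finsetSum _ fun a _ => (hw0 _).const_mul _]
    congr 1
    refine integral_congr_ae (Filter.Eventually.of_forall fun x => ?_)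
    simp only [eval_mul, eval_pow, eval_X]
    have he : (P c n).eval x = ∑ a ∈ Finset.range (n + 1), (P c n).coeff a * x ^ a := by
      rw [eval_eq_sum_range, hdeg c hc]
    calc _ = (∑ a ∈ Finset.range (n + 1), (P c n).coeff a * x ^ a) *
          ((P c n).eval x * G.eval x * w x) := by
          rw [Finset.sum_mul]
          exact Finset.sum_congr rfl fun a _ => by ring
      _ = _ := by rw [← he]; ring

theorem stmt15
    (D : ℕ) (hDeven : Even D) (hD2 : 2 ≤ D)
    (U : Set (Fin D → ℝ)) (hUopen : IsOpen U)
    (hUpos : ∀ u ∈ U, 0 < u ⟨D - 1, by omega⟩)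
    (Vf : (Fin D → ℝ) → ℝ → ℝ)
    (hVf : ∀ (u : Fin D → ℝ) (x : ℝ),
      Vf u x = ∑ i : Fin D, u i / ((i : ℕ) + 1) * x ^ ((i : ℕ) + 1))
    (hint : ∀ u ∈ U, ∀ q : Polynomial ℝ,
      Integrable (fun x : ℝ => q.eval x * Real.exp (-(Vf u x))))
    (p : (Fin D → ℝ) → ℕ → Polynomial ℝ)
    (hmonic : ∀ u ∈ U, ∀ n, (p u n).Monic)
    (hpdeg : ∀ u ∈ U, ∀ n, (p u n).natDegree = n)
    (horth : ∀ u ∈ U, ∀ n m, n ≠ m →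
      ∫ x : ℝ, (p u n).eval x * (p u m).eval x * Real.exp (-(Vf u x)) = 0)
    (h : (Fin D → ℝ) → ℕ → ℝ)
    (hh : ∀ (u : Fin D → ℝ) (n : ℕ),
      h u n = ∫ x : ℝ, ((p u n).eval x) ^ 2 * Real.exp (-(Vf u x)))
    (hhpos : ∀ u ∈ U, ∀ n, 0 < h u n)
    (ψ : (Fin D → ℝ) → ℕ → ℝ → ℝ)
    (hψ : ∀ (u : Fin D → ℝ) (n : ℕ) (x : ℝ),
      ψ u n x = (p u n).eval x * Real.exp (-(Vf u x) / 2) / Real.sqrt (h u n))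
    (hcoeff : ∀ n j, DifferentiableOn ℝ (fun u => (p u n).coeff j) U)
    (γ : (Fin D → ℝ) → ℕ → ℝ)
    (hγ : ∀ (u : Fin D → ℝ) (n : ℕ), 1 ≤ n → γ u n = Real.sqrt (h u n / h u (n - 1)))
    (M : (Fin D → ℝ) → ℕ → ℕ → ℕ → ℝ)
    (hM : ∀ (u : Fin D → ℝ) (k a b : ℕ),
      M u k a b = ∫ t : ℝ, t ^ k * ψ u a t * ψ u b t)
    (u : Fin D → ℝ) (hu : u ∈ U) (i : Fin D) (n : ℕ) (hn : 1 ≤ n) :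
    HasDerivAt (fun t => Real.log (γ (Function.update u i t) n))
      (-((M u ((i : ℕ) + 1) n n - M u ((i : ℕ) + 1) (n - 1) (n - 1))
          / (2 * ((i : ℕ) + 1 : ℝ))))
      (u i) := by
  set c := u i with hcdef
  have hupd : Function.update u i c = u := Function.update_eq_self i u
  have hcont : Continuous (fun t : ℝ => Function.update u i t) :=
    continuous_const.update i continuous_id
  obtain ⟨ε, hε, hball⟩ : ∃ ε > 0, ∀ t ∈ Metric.closedBall c ε, Function.update u i t ∈ U := by
    have hmem : (fun t : ℝ => Function.update u i t) ⁻¹' U ∈ nhds c :=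
      (hUopen.preimage hcont).mem_nhds (by simpa [hupd] using hu)
    exact Metric.nhds_basis_closedBall.mem_iff.1 hmem
  have hk : ((i : ℕ) + 1 : ℝ) ≠ 0 := by positivity
  set G : ℝ[X] := C ((i : ℕ) + 1 : ℝ)⁻¹ * X ^ ((i : ℕ) + 1) with hG
  have hV : ∀ t x, exp (-(Vf (Function.update u i t) x)) =
      exp (-(Vf u x)) * exp (-((t - c) * G.eval x)) := by
    intro t x
    rw [← exp_add, hVf, hVf]
    congr 1
    have hs : ∑ j : Fin D, (Function.update u i t j / ((j : ℕ) + 1) * x ^ ((j : ℕ) + 1) -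
        u j / ((j : ℕ) + 1) * x ^ ((j : ℕ) + 1)) = (t - c) * G.eval x := by
      rw [Finset.sum_eq_single i]
      · simp only [Function.update_self, hG, eval_mul, eval_C, eval_pow, eval_X, hcdef]
        field_simp
      · intro j _ hj
        simp [Function.update_of_ne hj]
      · simp
    rw [Finset.sum_sub_distrib] at hs
    linarith
  have hhd : ∀ m, HasDerivAt (fun t => h (Function.update u i t) m)
      (-∫ x, (p u m * p u m * G).eval x * exp (-(Vf u x))) c := by
    intro m
    have key := hasDerivAt_sq_norm_orthogonal (w := fun x => exp (-(Vf u x)))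
      (P := fun t => p (Function.update u i t)) hε G (fun _ => rfl)
      (fun t ht q => by simpa only [hV] using hint _ (hball t ht) q)
      (fun t ht => hmonic _ (hball t ht)) (fun t ht => hpdeg _ (hball t ht))
      (fun t ht a b hab => by
        simpa only [hV, eval_mul] using horth _ (hball t ht) a b hab)
      (fun a j => by
        have h1 : DifferentiableAt ℝ (fun v => (p v a).coeff j) (Function.update u i c) :=
          ((hcoeff a j) _ (by rwa [hupd])).differentiableAt (hUopen.mem_nhds (by rwa [hupd]))
        exact h1.comp c (hasDerivAt_update u i c).differentiableAt) m
    simp only [hupd] at key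
    refine key.congr_of_eventuallyEq (Filter.Eventually.of_forall fun t => ?_)
    simp only [hh, hV, eval_mul, sq]
  have hMm : ∀ m, (-∫ x, (p u m * p u m * G).eval x * exp (-(Vf u x))) / h u m =
      -(M u ((i : ℕ) + 1) m m / ((i : ℕ) + 1)) := by
    intro m
    have hpos := hhpos u hu m
    rw [hM, neg_div, ← integral_div, ← integral_div]
    congr 1
    refine integral_congr_ae (Filter.Eventually.of_forall fun x => ?_)
    have he : exp (-(Vf u x)) = exp (-(Vf u x) / 2) * exp (-(Vf u x) / 2) := by
      rw [← exp_add]; congr 1; ring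
    have hsq : √(h u m) * √(h u m) = h u m := Real.mul_self_sqrt hpos.le
    have hs0 : √(h u m) ≠ 0 := (Real.sqrt_pos.2 hpos).ne'
    simp only [hψ, hG, eval_mul, eval_C, eval_pow, eval_X, he]
    generalize √(h u m) = s at hsq hs0 ⊢
    rw [← hsq]
    field_simp
  have hlog : ∀ m, HasDerivAt (fun t => Real.log (h (Function.update u i t) m))
      (-(M u ((i : ℕ) + 1) m m / ((i : ℕ) + 1))) c := by
    intro m
    have := (hhd m).log (by rw [hupd]; exact (hhpos u hu m).ne')
    rwa [hupd, hMm] at this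
  refine ((((hlog n).sub (hlog (n - 1))).div_const 2).congr_of_eventuallyEq ?_).congr_deriv ?_
  · filter_upwards [Metric.closedBall_mem_nhds c hε] with t ht
    have h1 := hhpos _ (hball t ht) n
    have h2 := hhpos _ (hball t ht) (n - 1)
    simp only [Pi.sub_apply]
    rw [hγ _ _ hn, Real.log_sqrt (div_pos h1 h2).le, Real.log_div h1.ne' h2.ne']
  · field_simp
    ring
end
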